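/- For every u, v ∈ S_n, if P is a shortest directed path from u to v in the quantum Bruhat graph Γ_n and Q is any directed path from u to v, then the weight of Q is greater than or equal to the weight of P componentwise in ℤ^{n−1} (equivalently, the weight monomial q^{weight(Q)} is divisible by q^{weight(P)}). -/

import Mathlib

open Equiv

/-- Number of inversions of a permutation of `Fin n` (its Coxeter length). -/
def len (n : ℕ) (w : Equiv.Perm (Fin n)) : ℕ :=
  (Finset.univ.filter (fun p : Fin n × Fin n => p.1 < p.2 ∧ w p.2 < w p.1)).card

/-- The endpoint of the edge labeled `p = (i, j)` starting at `u`: right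
multiplication by the transposition `s_{ij}`. -/
def step (n : ℕ) (u : Equiv.Perm (Fin n)) (p : Fin n × Fin n) : Equiv.Perm (Fin n) :=
  u * Equiv.swap p.1 p.2

/-- `u → u·s_{ij}` is an edge of the quantum Bruhat graph `Γ_n`:
either `ℓ(u s_{ij}) = ℓ(u) + 1`, or `ℓ(u s_{ij}) = ℓ(u) + 1 - 2(j - i)`. -/
def isQBEdge (n : ℕ) (u : Equiv.Perm (Fin n)) (p : Fin n × Fin n) : Prop :=
  p.1 < p.2 ∧
    (len n (step n u p) = len n u + 1 ∨
     len n (step n u p) + 2 * ((p.2 : ℕ) - (p.1 : ℕ)) = len n u + 1)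

/-- The weight in `ℤ^{n-1}` of the edge labeled `p = (i,j)` starting at `u`:
`0` for a Bruhat cover, and `e_i + e_{i+1} + ⋯ + e_{j-1}` for a quantum edge.
(Here coordinates of `Fin (n-1)` are `0`-based: index `k` is the paper's `q_{k+1}`.) -/
def edgeWeight (n : ℕ) (u : Equiv.Perm (Fin n)) (p : Fin n × Fin n) : Fin (n - 1) → ℤ :=
  if len n (step n u p) = len n u + 1 then 0
  else fun k => if (p.1 : ℕ) ≤ (k : ℕ) ∧ (k : ℕ) < (p.2 : ℕ) then 1 else 0

/-- `isPath n u L v` : the list of labels `L` encodes a directed path from `u` to `v`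
in the quantum Bruhat graph `Γ_n`. -/
def isPath (n : ℕ) : Equiv.Perm (Fin n) → List (Fin n × Fin n) → Equiv.Perm (Fin n) → Prop
  | u, [], v => u = v
  | u, p :: ps, v => isQBEdge n u p ∧ isPath n (step n u p) ps v

/-- The weight of a directed path: the sum in `ℤ^{n-1}` of the weights of its edges. -/
def pathWeight (n : ℕ) : Equiv.Perm (Fin n) → List (Fin n × Fin n) → (Fin (n - 1) → ℤ)
  | _, [] => 0
  | u, p :: ps => edgeWeight n u p + pathWeight n (step n u p) ps

/-- Every edge of the path is length-increasing (a Bruhat cover). -/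
def allUp (n : ℕ) : Equiv.Perm (Fin n) → List (Fin n × Fin n) → Prop
  | _, [] => True
  | u, p :: ps => len n (step n u p) = len n u + 1 ∧ allUp n (step n u p) ps

/-- A path with labels `(a_1,b_1), …, (a_i,b_i)` is `y_k^i`-admissible if
`a_1 ≤ ⋯ ≤ a_i ≤ k < b_1, …, b_i` and the `b_t` are pairwise distinct.
(`k : Fin (n-1)` is `0`-based: it stands for the paper's `k+1`.) -/
def yAdm (n : ℕ) (k : Fin (n - 1)) (L : List (Fin n × Fin n)) : Prop :=
  List.Chain' (· ≤ ·) (L.map Prod.fst) ∧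
  (∀ p ∈ L, (p.1 : ℕ) ≤ (k : ℕ) ∧ (k : ℕ) < (p.2 : ℕ)) ∧
  (L.map Prod.snd).Nodup

/-- A path is `y^β`-admissible if it is a concatenation `P_1 ∘ ⋯ ∘ P_{n-1}` where
`P_k` is `y_k^{β_k}`-admissible. -/
def yBetaAdm (n : ℕ) (β : Fin (n - 1) → ℕ) (L : List (Fin n × Fin n)) : Prop :=
  ∃ Ls : Fin (n - 1) → List (Fin n × Fin n),
    L = (List.ofFn Ls).flatten ∧
    ∀ k : Fin (n - 1), (Ls k).length = β k ∧ yAdm n k (Ls k)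

/-- A path with labels `(a_1,b_1), …, (a_l,b_l)` is admissible if there are
`k_1 ≤ ⋯ ≤ k_l` with `a_t ≤ k_t < b_t` and the pairs `(k_t, b_t)` pairwise distinct. -/
def Adm (n : ℕ) (L : List (Fin n × Fin n)) : Prop :=
  ∃ ks : List ℕ, ks.length = L.length ∧ List.Chain' (· ≤ ·) ks ∧
    (∀ pr ∈ ks.zip L, (pr.2.1 : ℕ) ≤ pr.1 ∧ pr.1 < (pr.2.2 : ℕ)) ∧
    (ks.zip (L.map Prod.snd)).Nodup

/-- The longest permutation `w_o : i ↦ n + 1 - i` (0-based: `i ↦ n - 1 - i`). -/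
def wo (n : ℕ) : Equiv.Perm (Fin n) :=
  Function.Involutive.toPerm Fin.rev (fun i => Fin.rev_rev i)


/-- A sum over `Fin n` with the terms at two distinct indices split off. -/
lemma sum_eq_add_add_sum_erase {n : ℕ} {i j : Fin n} (hij : i ≠ j) (F : Fin n → ℤ) :
    ∑ a, F a = F i + F j + ∑ a ∈ (Finset.univ.erase i).erase j, F a := by
  rw [← Finset.add_sum_erase _ F (Finset.mem_univ i),
    ← Finset.add_sum_erase _ F (Finset.mem_erase.2 ⟨hij.symm, Finset.mem_univ j⟩), add_assoc]

lemma len_eq_sum (n : ℕ) (w : Equiv.Perm (Fin n)) :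
    (len n w : ℤ) = ∑ a, ∑ b, if a < b ∧ w b < w a then (1 : ℤ) else 0 := by
  rw [len, Finset.card_filter, ← Finset.univ_product_univ, Finset.sum_product]
  push_cast
  rfl

lemma len_le (n : ℕ) (w : Equiv.Perm (Fin n)) : len n w ≤ n * n := by
  refine (Finset.card_filter_le _ _).trans ?_
  simp

lemma step_apply_left {n : ℕ} (u : Equiv.Perm (Fin n)) (i j : Fin n) :
    step n u (i, j) i = u j := by
  simp [step]

lemma step_apply_right {n : ℕ} (u : Equiv.Perm (Fin n)) (i j : Fin n) :
    step n u (i, j) j = u i := by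
  simp [step]

lemma step_apply_of_ne {n : ℕ} (u : Equiv.Perm (Fin n)) {i j m : Fin n} (hi : m ≠ i)
    (hj : m ≠ j) : step n u (i, j) m = u m := by
  simp [step, Equiv.swap_apply_of_ne_of_ne hi hj]

lemma step_step {n : ℕ} (u : Equiv.Perm (Fin n)) (p : Fin n × Fin n) :
    step n (step n u p) p = u := by
  simp [step, mul_assoc]

/-- The positions strictly between `i` and `j` whose values under `u` lie strictly between
`u i` and `u j`. -/
def betweenSet {n : ℕ} (u : Equiv.Perm (Fin n)) (i j : Fin n) : Finset (Fin n) :=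
  Finset.univ.filter fun m => i < m ∧ m < j ∧ u i < u m ∧ u m < u j

/-- Length change under an increasing transposition. -/
lemma len_step {n : ℕ} (u : Equiv.Perm (Fin n)) {i j : Fin n} (hij : i < j)
    (h : u i < u j) :
    len n (step n u (i, j)) = len n u + 1 + 2 * (betweenSet u i j).card := by
  have hne : i ≠ j := hij.ne
  zify
  rw [len_eq_sum, len_eq_sum, betweenSet, Finset.card_filter]
  push_cast
  simp only [sum_eq_add_add_sum_erase hne, step_apply_left, step_apply_right,
    Finset.sum_add_distrib]
  set T := (Finset.univ.erase i).erase j with hT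
  have hTT : ∑ a ∈ T, ∑ b ∈ T,
      (if a < b ∧ step n u (i, j) b < step n u (i, j) a then (1 : ℤ) else 0) =
      ∑ a ∈ T, ∑ b ∈ T, if a < b ∧ u b < u a then (1 : ℤ) else 0 := by
    refine Finset.sum_congr rfl fun a ha => Finset.sum_congr rfl fun b hb => ?_
    simp only [hT, Finset.mem_erase, Finset.mem_univ, and_true] at ha hb
    rw [step_apply_of_ne u ha.2 ha.1, step_apply_of_ne u hb.2 hb.1]
  have key : ∑ m ∈ T, ((if i < m ∧ step n u (i, j) m < u j then (1 : ℤ) else 0) +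
        (if j < m ∧ step n u (i, j) m < u i then (1 : ℤ) else 0) +
        (if m < i ∧ u j < step n u (i, j) m then (1 : ℤ) else 0) +
        (if m < j ∧ u i < step n u (i, j) m then (1 : ℤ) else 0)) =
      ∑ m ∈ T, ((if i < m ∧ u m < u i then (1 : ℤ) else 0) +
        (if j < m ∧ u m < u j then (1 : ℤ) else 0) +
        (if m < i ∧ u i < u m then (1 : ℤ) else 0) +
        (if m < j ∧ u j < u m then (1 : ℤ) else 0) +
        2 * (if i < m ∧ m < j ∧ u i < u m ∧ u m < u j then (1 : ℤ) else 0)) := by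
    refine Finset.sum_congr rfl fun m hm => ?_
    simp only [hT, Finset.mem_erase, Finset.mem_univ, and_true] at hm
    rw [step_apply_of_ne u hm.2 hm.1]
    have h1 : u m ≠ u i := u.injective.ne hm.2
    have h2 : u m ≠ u j := u.injective.ne hm.1
    obtain ⟨h3, h4⟩ := hm
    simp only [Fin.lt_def, ne_eq, Fin.ext_iff] at *
    split_ifs <;> omega
  simp only [Finset.sum_add_distrib, ← Finset.mul_sum] at key
  simp only [lt_irrefl, false_and, and_false, if_false, hij, h, and_self, if_true, not_lt_of_gt hij,
    not_lt_of_gt h]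
  linarith

/-- Number of positions `m ≤ k` with `a ≤ w m`. -/
def prefixRank {n : ℕ} (w : Equiv.Perm (Fin n)) (k a : ℕ) : ℤ :=
  ∑ m : Fin n, if (m : ℕ) ≤ k ∧ a ≤ (w m : ℕ) then 1 else 0

lemma prefixRank_step {n : ℕ} (u : Equiv.Perm (Fin n)) {i j : Fin n} (hij : i < j)
    (k a : ℕ) :
    prefixRank (step n u (i, j)) k a = prefixRank u k a +
      if (i : ℕ) ≤ k ∧ k < (j : ℕ) then
        (if a ≤ (u j : ℕ) then 1 else 0) - (if a ≤ (u i : ℕ) then 1 else 0) else 0 := by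
  have hT : ∑ m ∈ (Finset.univ.erase i).erase j,
      (if (m : ℕ) ≤ k ∧ a ≤ (step n u (i, j) m : ℕ) then (1 : ℤ) else 0) =
      ∑ m ∈ (Finset.univ.erase i).erase j,
        if (m : ℕ) ≤ k ∧ a ≤ (u m : ℕ) then (1 : ℤ) else 0 := by
    refine Finset.sum_congr rfl fun m hm => ?_
    simp only [Finset.mem_erase, Finset.mem_univ, and_true] at hm
    rw [step_apply_of_ne u hm.2 hm.1]
  simp only [prefixRank, sum_eq_add_add_sum_erase hij.ne, hT, step_apply_left, step_apply_right]
  rw [Fin.lt_def] at hij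
  split_ifs <;> omega

lemma len_step_lt {n : ℕ} (u : Equiv.Perm (Fin n)) {i j : Fin n} (hij : i < j)
    (h : u j < u i) :
    len n u = len n (step n u (i, j)) + 1 + 2 * (betweenSet (step n u (i, j)) i j).card := by
  have := len_step (step n u (i, j)) hij (by rwa [step_apply_left, step_apply_right])
  rwa [step_step] at this

lemma lt_of_len_step {n : ℕ} (u : Equiv.Perm (Fin n)) {i j : Fin n} (hij : i < j)
    (h : len n (step n u (i, j)) = len n u + 1) : u i < u j := by
  by_contra hc
  have := len_step_lt u hij (lt_of_le_of_ne (not_lt.1 hc) (u.injective.ne hij.ne'))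
  omega

lemma prefixRank_sub_le_edgeWeight {n : ℕ} (u : Equiv.Perm (Fin n)) {p : Fin n × Fin n}
    (hp : isQBEdge n u p) (k : Fin (n - 1)) (a : ℕ) :
    prefixRank u k a - prefixRank (step n u p) k a ≤ edgeWeight n u p k := by
  obtain ⟨i, j⟩ := p
  have hij : i < j := hp.1
  rw [prefixRank_step u hij, edgeWeight]
  by_cases h : len n (step n u (i, j)) = len n u + 1
  · have := lt_of_len_step u hij h
    rw [Fin.lt_def] at this
    simp only [h, if_true, Pi.zero_apply]
    split_ifs <;> omega
  · simp only [h, if_false]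
    split_ifs <;> omega

lemma prefixRank_sub_le_pathWeight {n : ℕ} (L : List (Fin n × Fin n))
    (u v : Equiv.Perm (Fin n)) (hL : isPath n u L v) (k : Fin (n - 1)) (a : ℕ) :
    prefixRank u k a - prefixRank v k a ≤ pathWeight n u L k := by
  induction L generalizing u with
  | nil =>
    obtain rfl : u = v := hL
    simp [pathWeight]
  | cons p L ih =>
    have h1 := prefixRank_sub_le_edgeWeight u hL.1 k a
    have h2 := ih _ hL.2
    simp only [pathWeight, Pi.add_apply]
    linarith

lemma sum_indicator_Ico {n : ℕ} {i j : Fin n} (hij : i < j) :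
    ∑ k : Fin (n - 1), (if (i : ℕ) ≤ (k : ℕ) ∧ (k : ℕ) < (j : ℕ) then (1 : ℤ) else 0) =
      (j : ℤ) - i := by
  rw [Fin.sum_univ_eq_sum_range (fun k => if (i : ℕ) ≤ k ∧ k < (j : ℕ) then (1 : ℤ) else 0) (n - 1),
    Finset.sum_boole]
  have : (Finset.range (n - 1)).filter (fun k => (i : ℕ) ≤ k ∧ k < (j : ℕ)) =
      Finset.Ico (i : ℕ) j := by
    ext k
    simp only [Finset.mem_filter, Finset.mem_range, Finset.mem_Ico]
    omega
  rw [this, Nat.card_Ico]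
  rw [Fin.lt_def] at hij
  omega

lemma len_step_eq_of_edge {n : ℕ} (u : Equiv.Perm (Fin n)) {p : Fin n × Fin n}
    (hp : isQBEdge n u p) :
    (len n (step n u p) : ℤ) = len n u + 1 - 2 * ∑ k, edgeWeight n u p k := by
  obtain ⟨i, j⟩ := p
  obtain ⟨hij, hl⟩ := hp
  by_cases h : len n (step n u (i, j)) = len n u + 1
  · simp [edgeWeight, h]
  · have hs := sum_indicator_Ico hij
    have hl' := hl.resolve_left h
    simp only [edgeWeight, h, if_false]
    rw [hs]
    simp only [Fin.lt_def] at *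
    omega

lemma length_eq_of_isPath {n : ℕ} (L : List (Fin n × Fin n)) (u v : Equiv.Perm (Fin n))
    (hL : isPath n u L v) :
    (L.length : ℤ) = len n v - len n u + 2 * ∑ k, pathWeight n u L k := by
  induction L generalizing u with
  | nil =>
    obtain rfl : u = v := hL
    simp [pathWeight]
  | cons p L ih =>
    have h1 := len_step_eq_of_edge u hL.1
    have h2 := ih _ hL.2
    simp only [pathWeight, Pi.add_apply, Finset.sum_add_distrib, List.length_cons]
    push_cast
    linarith

/-- `c` lies in the half-open cyclic interval `(x, y]`. -/
def InCyclicIoc (x y c : ℕ) : Prop := (x < c ∧ c ≤ y) ∨ (y < x ∧ (x < c ∨ c ≤ y))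

/-- If `j` is the first position after `i` whose value lies in the cyclic interval `(u i, y]`,
then `(i, j)` labels an edge starting at `u`. -/
lemma isQBEdge_of_first {n : ℕ} (u : Equiv.Perm (Fin n)) {i j : Fin n} (hij : i < j) {y : ℕ}
    (hj : InCyclicIoc (u i) y (u j))
    (hmin : ∀ m, i < m → m < j → ¬ InCyclicIoc (u i) y (u m)) :
    isQBEdge n u (i, j) ∧ (len n (step n u (i, j)) = len n u + 1 ↔ u i < u j) := by
  by_cases h : u i < u j
  · have hb : betweenSet u i j = ∅ := by
      refine Finset.filter_eq_empty_iff.2 fun m _ hm => hmin m hm.1 hm.2.1 ?_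
      simp only [InCyclicIoc, Fin.lt_def] at *
      omega
    have hl := len_step u hij h
    rw [hb, Finset.card_empty] at hl
    exact ⟨⟨hij, Or.inl hl⟩, by simp [h, hl]⟩
  · have h' : u j < u i := lt_of_le_of_ne (not_lt.1 h) (u.injective.ne hij.ne')
    have hb : betweenSet (step n u (i, j)) i j = Finset.Ioo i j := by
      ext m
      simp only [betweenSet, Finset.mem_filter, Finset.mem_univ, true_and, Finset.mem_Ioo,
        step_apply_left, step_apply_right]
      refine ⟨fun hm => ⟨hm.1, hm.2.1⟩, fun hm => ⟨hm.1, hm.2, ?_⟩⟩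
      rw [step_apply_of_ne u hm.1.ne' hm.2.ne]
      have h1 := hmin m hm.1 hm.2
      have h2 : u m ≠ u i := u.injective.ne hm.1.ne'
      have h3 : u m ≠ u j := u.injective.ne hm.2.ne
      simp only [InCyclicIoc, Fin.lt_def, ne_eq, Fin.ext_iff] at *
      omega
    have hl := len_step_lt u hij h'
    rw [hb, Fin.card_Ioo] at hl
    refine ⟨⟨hij, Or.inr ?_⟩, by simp only [h, iff_false]; omega⟩
    rw [Fin.lt_def] at hij
    simp only
    omega

/-- On the cyclic interval `(u i, v i]`, the rank difference is not maximal. -/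
lemma prefixRank_sub_lt {n : ℕ} (u v : Equiv.Perm (Fin n)) {i j : Fin n}
    (hagree : ∀ m < i, u m = v m)
    (hmin : ∀ m, i < m → m < j → ¬ InCyclicIoc (u i) (v i) (u m))
    {k : ℕ} (hik : (i : ℕ) ≤ k) (hkj : k < (j : ℕ)) {a : ℕ}
    (ha : InCyclicIoc (u i) (v i) a) :
    prefixRank u k a - prefixRank v k a <
      prefixRank u k (v i + 1) - prefixRank v k (v i + 1) := by
  simp only [prefixRank, ← Finset.sum_sub_distrib]
  have hterm : ∀ m : Fin n, (m < i ∧ u m = v m) ∨ m = i ∨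
      (i < m ∧ ((m : ℕ) ≤ k → ¬ InCyclicIoc (u i) (v i) (u m)) ∧ u m ≠ u i) := by
    intro m
    rcases lt_trichotomy m i with h | h | h
    · exact Or.inl ⟨h, hagree m h⟩
    · exact Or.inr (Or.inl h)
    · exact Or.inr (Or.inr ⟨h, fun hm => hmin m h (by rw [Fin.lt_def]; omega),
        u.injective.ne h.ne'⟩)
  refine Finset.sum_lt_sum (fun m _ => ?_) ⟨i, Finset.mem_univ _, ?_⟩
  · rcases hterm m with ⟨_, h⟩ | rfl | ⟨_, h, h'⟩
    · rw [h]; simp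
    · simp only [InCyclicIoc] at ha
      split_ifs <;> omega
    · simp only [InCyclicIoc, ne_eq, Fin.ext_iff] at ha h h'
      split_ifs <;> omega
  · simp only [InCyclicIoc] at ha
    split_ifs <;> omega

lemma exists_first_position {n : ℕ} {u v : Equiv.Perm (Fin n)} (huv : u ≠ v) :
    ∃ i j : Fin n, i < j ∧ (∀ m < i, u m = v m) ∧ InCyclicIoc (u i) (v i) (u j) ∧
      ∀ m, i < m → m < j → ¬ InCyclicIoc (u i) (v i) (u m) := by
  classical
  obtain ⟨m₀, hm₀⟩ : ∃ m, u m ≠ v m := by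
    by_contra! h
    exact huv (Equiv.ext h)
  have hwf : WellFounded ((· < ·) : Fin n → Fin n → Prop) := wellFounded_lt
  obtain ⟨i, hi, hi'⟩ := hwf.has_min {m | u m ≠ v m} ⟨m₀, hm₀⟩
  have hagree : ∀ m < i, u m = v m := fun m hm => by
    by_contra h
    exact hi' m h hm
  have hi : u i ≠ v i := hi
  have hex : (u.symm (v i)) ∈ {m | i < m ∧ InCyclicIoc (u i) (v i) (u m)} := by
    refine ⟨?_, ?_⟩
    · rcases lt_trichotomy (u.symm (v i)) i with h | h | h
      · have := hagree _ h
        rw [Equiv.apply_symm_apply] at this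
        exact absurd (v.injective this) h.ne'
      · exact absurd (by rw [← h, Equiv.apply_symm_apply, h]) hi
      · exact h
    · rw [Equiv.apply_symm_apply]
      simp only [InCyclicIoc, ne_eq, Fin.ext_iff] at *
      omega
  obtain ⟨j, hj, hj'⟩ := hwf.has_min _ ⟨_, hex⟩
  exact ⟨i, j, hj.1, hagree, hj.2, fun m him hmj hm => hj' m ⟨him, hm⟩ hmj⟩

/-- Every vector dominating all rank differences bounds the weight of some path. -/
lemma exists_path_of_prefixRank_le {n : ℕ} (v : Equiv.Perm (Fin n)) (N : ℕ)
    (u : Equiv.Perm (Fin n)) (d : Fin (n - 1) → ℤ)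
    (hd : ∀ k a, prefixRank u (k : Fin (n - 1)) a - prefixRank v k a ≤ d k)
    (hN : 2 * ∑ k, d k + n * n - len n u < N) :
    ∃ L, isPath n u L v ∧ ∀ k, pathWeight n u L k ≤ d k := by
  induction N generalizing u d with
  | zero =>
    have h1 : 0 ≤ ∑ k, d k := Finset.sum_nonneg fun k _ => by
      have := hd k 0
      simpa [prefixRank] using this
    have h2 : (len n u : ℤ) ≤ n * n := by exact_mod_cast len_le n u
    push_cast at hN
    linarith
  | succ N ih =>
    by_cases huv : u = v
    · refine ⟨[], huv, fun k => ?_⟩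
      have := hd k 0
      simpa [prefixRank, pathWeight] using this
    obtain ⟨i, j, hij, hagree, hj, hmin⟩ := exists_first_position huv
    obtain ⟨hedge, hup⟩ := isQBEdge_of_first u hij hj hmin
    obtain ⟨L, hL, hw⟩ := ih (step n u (i, j)) (d - edgeWeight n u (i, j)) (fun k a => by
      have h1 := hd k a
      rw [prefixRank_step u hij, Pi.sub_apply, edgeWeight]
      by_cases hk : (i : ℕ) ≤ k ∧ (k : ℕ) < j
      · have h2 := hd k (v i + 1)
        have h3 := fun ha => prefixRank_sub_lt u v hagree hmin hk.1 hk.2 (a := a) ha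
        simp only [hup, hk, and_self, if_true]
        simp only [InCyclicIoc, Fin.lt_def] at *
        by_cases hlt : (u i : ℕ) < u j
        · simp only [hlt, if_true, Pi.zero_apply]
          by_cases ha : (u i : ℕ) < a ∧ a ≤ u j
          · have := h3 (by omega)
            split_ifs <;> omega
          · split_ifs <;> omega
        · simp only [hlt, if_false]
          by_cases ha : (u j : ℕ) < a ∧ a ≤ u i
          · split_ifs <;> omega
          · have := h3 (by omega)
            split_ifs <;> omega
      · simp only [hk, if_false]
        split_ifs <;> simp <;> omega) (by
      have := len_step_eq_of_edge u hedge
      simp only [Pi.sub_apply, Finset.sum_sub_distrib]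
      push_cast at hN
      linarith)
    refine ⟨(i, j) :: L, ⟨hedge, hL⟩, fun k => ?_⟩
    have := hw k
    simp only [pathWeight, Pi.add_apply, Pi.sub_apply] at *
    linarith

/-- If `P` is a shortest directed path from `u` to `v` in the quantum Bruhat graph
`Γ_n` and `Q` is any directed path from `u` to `v`, then the weight of `Q` is
componentwise at least that of `P`. -/
theorem path_weight_divisible_by_minimal (n : ℕ) (hn : 2 ≤ n) (u v : Equiv.Perm (Fin n))
    (P Q : List (Fin n × Fin n))
    (hP : isPath n u P v)
    (hPmin : ∀ L : List (Fin n × Fin n), isPath n u L v → P.length ≤ L.length)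
    (hQ : isPath n u Q v) :
    ∀ k : Fin (n - 1), pathWeight n u P k ≤ pathWeight n u Q k := by
  obtain ⟨R, hR, hRw⟩ := exists_path_of_prefixRank_le v _ u
    (fun k => min (pathWeight n u P k) (pathWeight n u Q k))
    (fun k a => le_min (prefixRank_sub_le_pathWeight P u v hP k a)
      (prefixRank_sub_le_pathWeight Q u v hQ k a))
    (lt_of_le_of_lt (Int.self_le_toNat _) (by exact_mod_cast Nat.lt_succ_self _))
  have hlen : (P.length : ℤ) ≤ R.length := by exact_mod_cast hPmin R hR
  rw [length_eq_of_isPath P u v hP, length_eq_of_isPath R u v hR] at hlen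
  have hle : ∀ k ∈ Finset.univ, pathWeight n u R k ≤ pathWeight n u P k :=
    fun k _ => (hRw k).trans (min_le_left _ _)
  have hsum : ∑ k, pathWeight n u R k = ∑ k, pathWeight n u P k :=
    le_antisymm (Finset.sum_le_sum hle) (by linarith)
  intro k
  rw [← (Finset.sum_eq_sum_iff_of_le hle).1 hsum k (Finset.mem_univ k)]
  exact (hRw k).trans (min_le_right _ _)
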